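/- arXiv:0906.2558 — 6 statements merged into one kernel-verified Lean document; each statement's English description precedes it below -/
import Mathlib

section
/- If G, H ∈ 𝒢₀ are unlabeled graphs of finite norm with d(G, H) = 0, then for every ε ≥ 0 one has cut(G, ε) = cut(H, ε). -/
open scoped ENNReal
open Filter Topology

/-- Edges: 2-element subsets of the vertex set `ℕ`. -/
abbrev Edge : Type := {e : Sym2 ℕ // ¬ e.IsDiag}

/-- A labeled graph: an assignment of a real weight to each edge. -/
abbrev LGraph : Type := Edge → ℝ

/-- The norm of a labeled graph: the sum of the absolute values of its edge weights. -/
noncomputable def gnorm (w : LGraph) : ℝ≥0∞ := ∑' e : Edge, ENNReal.ofReal |w e|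

/-- A labeled graph has finite norm if its norm is finite. -/
def FiniteNorm (w : LGraph) : Prop := gnorm w ≠ ⊤

/-- The distance between two labeled graphs: `d(w,w') = |w - w'|`. -/
noncomputable def ldist (w w' : LGraph) : ℝ≥0∞ := ∑' e : Edge, ENNReal.ofReal |w e - w' e|

/-- A vertex is isolated if every edge containing it has weight `0`. -/
def Isolated (w : LGraph) (v : ℕ) : Prop := ∀ e : Edge, v ∈ e.val → w e = 0

/-- A labeled graph is standard if it has infinitely many isolated vertices. -/
def Standard (w : LGraph) : Prop := {v : ℕ | Isolated w v}.Infinite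

/-- The image of an edge under a bijection of the vertex set. -/
def mapEdge (f : ℕ ≃ ℕ) (e : Edge) : Edge :=
  ⟨e.val.map f, fun h => e.prop ((Sym2.isDiag_map f.injective).mp h)⟩

/-- Two labeled graphs are isomorphic if some bijection of the vertices carries the
weights of one to the other: `w(uv) = w'(f(u)f(v))` for all edges `uv`. -/
def GIso (w w' : LGraph) : Prop := ∃ f : ℕ ≃ ℕ, ∀ e : Edge, w e = w' (mapEdge f e)

/-- The isomorphism class of a labeled graph (as a set of labeled graphs). -/
def cls (w : LGraph) : Set LGraph := {w' | GIso w w'}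

/-- The distance between the isomorphism classes of two labeled graphs:
`d(G,G') = inf { d(u,v) : u ∈ G, v ∈ G' }`. -/
noncomputable def Gdist (w₁ w₂ : LGraph) : ℝ≥0∞ := ⨅ u ∈ cls w₁, ⨅ v ∈ cls w₂, ldist u v

/-- `cutL w ε` replaces by `0` the weight of every edge `e` with `|w e| < ε`. -/
noncomputable def cutL (w : LGraph) (eps : ℝ) : LGraph :=
  fun e => if |w e| < eps then 0 else w e

lemma mapEdge_symm_apply (f : ℕ ≃ ℕ) (e : Edge) : mapEdge f.symm (mapEdge f e) = e := by
  apply Subtype.ext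
  simp [mapEdge, Sym2.map_map]

lemma mapEdge_apply_symm (f : ℕ ≃ ℕ) (e : Edge) : mapEdge f (mapEdge f.symm e) = e :=
  mapEdge_symm_apply f.symm e

lemma abs_sub_le_ldist (u v : LGraph) (e : Edge) : ENNReal.ofReal |u e - v e| ≤ ldist u v :=
  ENNReal.le_tsum (f := fun e : Edge => ENNReal.ofReal |u e - v e|) e

/-- A graph of finite norm has only finitely many edges of weight bounded away from `0`. -/
lemma FiniteNorm.finite_le_abs {w : LGraph} (hw : FiniteNorm w) {c : ℝ} (hc : 0 < c) :
    {e : Edge | c ≤ |w e|}.Finite := by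
  have h := ENNReal.finite_const_le_of_tsum_ne_top (a := fun e : Edge => ENNReal.ofReal |w e|) hw
    (ε := ENNReal.ofReal c) (by simpa using hc)
  refine h.subset fun e he => ?_
  exact ENNReal.ofReal_le_ofReal he

/-- Classes at distance `0` are matched up to arbitrarily small uniform error. -/
lemma exists_equiv_of_Gdist_eq_zero {w w' : LGraph} (h : Gdist w w' = 0) {c : ℝ} (hc : 0 < c) :
    ∃ f : ℕ ≃ ℕ, ∀ e, |w e - w' (mapEdge f e)| < c := by
  have hlt : Gdist w w' < ENNReal.ofReal c := by rw [h]; simpa using hc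
  simp only [Gdist, iInf_lt_iff] at hlt
  obtain ⟨u, ⟨a, ha⟩, v, ⟨b, hb⟩, huv⟩ := hlt
  refine ⟨a.trans b.symm, fun e => ?_⟩
  have h1 : mapEdge b (mapEdge (a.trans b.symm) e) = mapEdge a e := by
    apply Subtype.ext
    simp only [mapEdge, Sym2.map_map]
    congr 1
    ext x
    simp
  rw [ha, hb, h1]
  exact (ENNReal.ofReal_lt_ofReal_iff hc).1 ((abs_sub_le_ldist u v _).trans_lt huv)

/-- Vertex bijections that asymptotically match `w` with `w'` along the filter `U`. -/
def AsympIso (U : Ultrafilter ℕ) (f : ℕ → ℕ ≃ ℕ) (w w' : LGraph) : Prop :=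
  ∀ c : ℝ, 0 < c → ∀ᶠ n in (U : Filter ℕ), ∀ e, |w e - w' (mapEdge (f n) e)| < c

lemma AsympIso.symm {U : Ultrafilter ℕ} {f : ℕ → ℕ ≃ ℕ} {w w' : LGraph}
    (h : AsympIso U f w w') : AsympIso U (fun n => (f n).symm) w' w := by
  intro c hc
  filter_upwards [h c hc] with n hn e
  have := hn (mapEdge (f n).symm e)
  rwa [mapEdge_apply_symm, abs_sub_comm] at this

/-- The images of a non-isolated vertex stabilize along the ultrafilter. -/
lemma AsympIso.exists_limit {U : Ultrafilter ℕ} {f : ℕ → ℕ ≃ ℕ} {w w' : LGraph}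
    (h : AsympIso U f w w') (hf' : FiniteNorm w') {v : ℕ} (hv : ¬ Isolated w v) :
    ∃ u, ∀ᶠ n in (U : Filter ℕ), f n v = u := by
  simp only [Isolated, not_forall] at hv
  obtain ⟨e, hve, he⟩ := hv
  have hpos : 0 < |w e| / 2 := half_pos (abs_pos.2 he)
  have hTfin : {e' : Edge | |w e| / 2 ≤ |w' e'|}.Finite := hf'.finite_le_abs hpos
  have hfin : (⋃ e' ∈ {e' : Edge | |w e| / 2 ≤ |w' e'|}, {x | x ∈ e'.val}).Finite := by
    refine hTfin.biUnion fun e' _ => ?_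
    obtain ⟨e', -⟩ := e'
    induction e' with
    | _ x y =>
      refine (Set.toFinite {x, y}).subset fun z hz => ?_
      simpa using hz
  have hev : ∀ᶠ n in (U : Filter ℕ),
      ∃ u ∈ (⋃ e' ∈ {e' : Edge | |w e| / 2 ≤ |w' e'|}, {x | x ∈ e'.val}), f n v = u := by
    filter_upwards [h _ hpos] with n hn
    refine ⟨f n v, ?_, rfl⟩
    simp only [Set.mem_iUnion]
    refine ⟨mapEdge (f n) e, ?_, Sym2.mem_map.2 ⟨v, hve, rfl⟩⟩
    have h1 := hn e
    have h2 := abs_sub_abs_le_abs_sub (w e) (w' (mapEdge (f n) e))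
    change |w e| / 2 ≤ |w' (mapEdge (f n) e)|
    linarith
  obtain ⟨u, -, hu⟩ := (Ultrafilter.eventually_exists_mem_iff hfin).1 hev
  exact ⟨u, hu⟩

lemma AsympIso.weight_eq {U : Ultrafilter ℕ} {f : ℕ → ℕ ≃ ℕ} {w w' : LGraph}
    (h : AsympIso U f w w') {e e' : Edge}
    (he : ∀ᶠ n in (U : Filter ℕ), mapEdge (f n) e = e') : w e = w' e' := by
  refine eq_of_abs_sub_nonpos (le_of_forall_pos_lt_add fun c hc => ?_)
  obtain ⟨n, hn, hne⟩ := ((h c hc).and he).exists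
  have := hn e
  rw [hne] at this
  simpa using this

lemma eventually_mapEdge {U : Ultrafilter ℕ} {f : ℕ → ℕ ≃ ℕ} {e e' : Edge} {g : ℕ → ℕ}
    (hg : ∀ v ∈ e.val, ∀ᶠ n in (U : Filter ℕ), f n v = g v) (he' : e'.val = e.val.map g) :
    ∀ᶠ n in (U : Filter ℕ), mapEdge (f n) e = e' := by
  obtain ⟨e, hd⟩ := e
  induction e with
  | _ x y =>
    filter_upwards [hg x (by simp), hg y (by simp)] with n hx hy
    apply Subtype.ext
    simp [mapEdge, he', hx, hy]

lemma AsympIso.not_isolated {U : Ultrafilter ℕ} {f : ℕ → ℕ ≃ ℕ} {w w' : LGraph}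
    (h : AsympIso U f w w') (hf' : FiniteNorm w') {v u : ℕ} (hv : ¬ Isolated w v)
    (hu : ∀ᶠ n in (U : Filter ℕ), f n v = u) : ¬ Isolated w' u := by
  simp only [Isolated, not_forall] at hv
  obtain ⟨e, hve, he⟩ := hv
  have hlim : ∀ x, ∃ y, x ∈ e.val → ∀ᶠ n in (U : Filter ℕ), f n x = y := by
    intro x
    by_cases hx : x ∈ e.val
    · obtain ⟨y, hy⟩ := h.exists_limit hf' (v := x) fun hi => he (hi e hx)
      exact ⟨y, fun _ => hy⟩
    · exact ⟨0, fun hx' => absurd hx' hx⟩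
  choose g hg using hlim
  have hmap : ∀ᶠ n in (U : Filter ℕ), (mapEdge (f n) e).val = e.val.map g := by
    obtain ⟨e, hd⟩ := e
    induction e with
    | _ x y =>
      filter_upwards [hg x (by simp), hg y (by simp)] with n hx hy
      simp [mapEdge, hx, hy]
  obtain ⟨n, hn, hnu⟩ := (hmap.and hu).exists
  have hw := h.weight_eq (eventually_mapEdge hg hn)
  intro hi
  refine he (hw.trans (hi _ ?_))
  exact Sym2.mem_map.2 ⟨v, hve, hnu⟩

/-- Standard graphs of finite norm that are asymptotically matched are isomorphic. -/
lemma AsympIso.gIso {U : Ultrafilter ℕ} {f : ℕ → ℕ ≃ ℕ} {w w' : LGraph}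
    (h : AsympIso U f w w') (hs : Standard w) (hf : FiniteNorm w)
    (hs' : Standard w') (hf' : FiniteNorm w') : GIso w w' := by
  classical
  choose φ hφ using fun v : {v // ¬ Isolated w v} => h.exists_limit hf' v.2
  choose ψ hψ using fun v : {v // ¬ Isolated w' v} => h.symm.exists_limit hf v.2
  let E : {v // ¬ Isolated w v} ≃ {v // ¬ Isolated w' v} :=
    { toFun := fun v => ⟨φ v, h.not_isolated hf' v.2 (hφ v)⟩
      invFun := fun v => ⟨ψ v, h.symm.not_isolated hf v.2 (hψ v)⟩
      left_inv := fun v => by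
        obtain ⟨n, h1, h2⟩ :=
          ((hφ v).and (hψ ⟨φ v, h.not_isolated hf' v.2 (hφ v)⟩)).exists
        apply Subtype.ext
        exact h2.symm.trans ((f n).symm_apply_eq.2 h1.symm)
      right_inv := fun v => by
        obtain ⟨n, h1, h2⟩ :=
          ((hψ v).and (hφ ⟨ψ v, h.symm.not_isolated hf v.2 (hψ v)⟩)).exists
        apply Subtype.ext
        exact h2.symm.trans ((f n).symm_apply_eq.1 h1).symm }
  have : Infinite {v // Isolated w v} := hs.to_subtype
  have : Infinite {v // Isolated w' v} := hs'.to_subtype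
  obtain ⟨F⟩ : Nonempty ({v // Isolated w v} ≃ {v // Isolated w' v}) :=
    nonempty_equiv_of_countable
  let g : ℕ ≃ ℕ := Equiv.subtypeCongr F E
  have hgE : ∀ v (hv : ¬ Isolated w v), g v = φ ⟨v, hv⟩ := fun v hv => by
    simp [g, Equiv.subtypeCongr, E, Equiv.sumCompl_symm_apply_of_neg hv]
  have hgF : ∀ v, Isolated w v → Isolated w' (g v) := fun v hv => by
    have : g v = F ⟨v, hv⟩ := by
      simp [g, Equiv.subtypeCongr, Equiv.sumCompl_symm_apply_of_pos hv]
    rw [this]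
    exact (F ⟨v, hv⟩).2
  refine ⟨g, fun e => ?_⟩
  by_cases hiso : ∃ v ∈ e.val, Isolated w v
  · obtain ⟨v, hve, hv⟩ := hiso
    rw [hv e hve, hgF v hv _ (Sym2.mem_map.2 ⟨v, hve, rfl⟩)]
  · push Not at hiso
    refine h.weight_eq (eventually_mapEdge (g := g) (fun v hv => ?_) rfl)
    rw [hgE v (hiso v hv)]
    exact hφ ⟨v, hiso v hv⟩

lemma GIso.cutL {w w' : LGraph} (h : GIso w w') (eps : ℝ) :
    GIso (cutL w eps) (cutL w' eps) := by
  obtain ⟨f, hf⟩ := h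
  exact ⟨f, fun e => by simp only [_root_.cutL, hf e]⟩

/-- If two unlabeled graphs of finite norm are at distance `0`, then all their cuts
agree. -/
theorem cut_eq_of_dist_eq_zero (w w' : LGraph)
    (hs : Standard w) (hf : FiniteNorm w) (hs' : Standard w') (hf' : FiniteNorm w')
    (h : Gdist w w' = 0) :
    ∀ eps : ℝ, 0 ≤ eps → GIso (cutL w eps) (cutL w' eps) := by
  intro eps _
  choose f hfe using fun n : ℕ =>
    exists_equiv_of_Gdist_eq_zero h (Nat.one_div_pos_of_nat (α := ℝ) (n := n))
  have hU : AsympIso (hyperfilter ℕ) f w w' := by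
    intro c hc
    have hlim := (tendsto_one_div_add_atTop_nhds_zero_nat (𝕜 := ℝ)).eventually_lt_const hc
    filter_upwards [Nat.hyperfilter_le_atTop hlim] with n hn e
    exact (hfe n e).trans hn
  exact (hU.gIso hs hf hs' hf').cutL eps
end

section
/- Let G, G₁, G₂, … ∈ 𝒢₀ be unlabeled graphs of finite norm. The following are equivalent: (1) d(Gₙ, G) → 0; (2) for every representative w ∈ G there exists a sequence of representatives wₙ ∈ Gₙ with d(wₙ, w) → 0; (3) there exist a representative w ∈ G and representatives wₙ ∈ Gₙ with d(wₙ, w) → 0. -/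
open scoped ENNReal
open Filter Topology

theorem mapEdge_trans (f h : ℕ ≃ ℕ) (e : Edge) :
    mapEdge (f.trans h) e = mapEdge h (mapEdge f e) := by
  apply Subtype.ext
  simp [mapEdge, Sym2.map_map]

theorem mapEdge_refl (e : Edge) : mapEdge (Equiv.refl ℕ) e = e := by
  apply Subtype.ext
  simp [mapEdge]

/-- The permutation of the edges induced by a permutation of the vertices. -/
def edgePerm (f : ℕ ≃ ℕ) : Edge ≃ Edge where
  toFun := mapEdge f
  invFun := mapEdge f.symm
  left_inv e := by rw [← mapEdge_trans, Equiv.self_trans_symm, mapEdge_refl]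
  right_inv e := by rw [← mapEdge_trans, Equiv.symm_trans_self, mapEdge_refl]

theorem ldist_relabel (f : ℕ ≃ ℕ) (w w' : LGraph) :
    ldist (fun e => w (mapEdge f e)) (fun e => w' (mapEdge f e)) = ldist w w' :=
  (edgePerm f).tsum_eq fun e => ENNReal.ofReal |w e - w' e|

theorem GIso.refl (w : LGraph) : GIso w w :=
  ⟨Equiv.refl ℕ, fun e => by rw [mapEdge_refl]⟩

theorem GIso.symm {w w' : LGraph} : GIso w w' → GIso w' w := by
  rintro ⟨f, hf⟩
  refine ⟨f.symm, fun e => ?_⟩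
  rw [hf, ← mapEdge_trans, Equiv.symm_trans_self, mapEdge_refl]

theorem GIso.trans {w₁ w₂ w₃ : LGraph} : GIso w₁ w₂ → GIso w₂ w₃ → GIso w₁ w₃ := by
  rintro ⟨f, hf⟩ ⟨h, hh⟩
  exact ⟨f.trans h, fun e => by rw [hf, hh, mapEdge_trans]⟩

theorem Gdist_le_ldist {w₁ w₂ u v : LGraph} (hu : u ∈ cls w₁) (hv : v ∈ cls w₂) :
    Gdist w₁ w₂ ≤ ldist u v :=
  (iInf₂_le u hu).trans (iInf₂_le v hv)

/-- The distance to a class can be approximated using any fixed representative of it. -/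
theorem exists_ldist_lt_of_Gdist_lt {w₁ w₂ u : LGraph} (hu : u ∈ cls w₂) {c : ℝ≥0∞}
    (hc : Gdist w₁ w₂ < c) : ∃ v ∈ cls w₁, ldist v u < c := by
  simp only [Gdist, iInf_lt_iff] at hc
  obtain ⟨x, hx, y, hy, hxy⟩ := hc
  obtain ⟨k, hk⟩ : GIso u y := (GIso.symm hu).trans hy
  refine ⟨fun e => x (mapEdge k e), GIso.trans hx (GIso.symm ⟨k, fun _ => rfl⟩), ?_⟩
  rwa [funext hk, ldist_relabel]

theorem exists_tendsto_of_tendsto_Gdist {w u : LGraph} (hu : u ∈ cls w) {g : ℕ → LGraph}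
    (h : Tendsto (fun n => Gdist (g n) w) atTop (𝓝 0)) :
    ∃ v : ℕ → LGraph, (∀ n, v n ∈ cls (g n)) ∧
      Tendsto (fun n => ldist (v n) u) atTop (𝓝 0) := by
  have approx : ∀ n : ℕ, ∃ v ∈ cls (g n), ldist v u ≤ Gdist (g n) w + (n : ℝ≥0∞)⁻¹ := by
    intro n
    by_cases htop : Gdist (g n) w = ⊤
    · exact ⟨g n, GIso.refl _, by simp [htop]⟩
    · obtain ⟨v, hv, hlt⟩ := exists_ldist_lt_of_Gdist_lt hu
        (ENNReal.lt_add_right htop (ENNReal.inv_ne_zero.2 (ENNReal.natCast_ne_top n)))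
      exact ⟨v, hv, hlt.le⟩
  choose v hv hle using approx
  refine ⟨v, hv, tendsto_of_tendsto_of_tendsto_of_le_of_le tendsto_const_nhds ?_
    (fun _ => zero_le) hle⟩
  simpa using h.add ENNReal.tendsto_inv_nat_nhds_zero

theorem tendsto_Gdist_of_tendsto_ldist {w u : LGraph} (hu : u ∈ cls w) {g v : ℕ → LGraph}
    (hv : ∀ n, v n ∈ cls (g n)) (h : Tendsto (fun n => ldist (v n) u) atTop (𝓝 0)) :
    Tendsto (fun n => Gdist (g n) w) atTop (𝓝 0) :=
  tendsto_of_tendsto_of_tendsto_of_le_of_le tendsto_const_nhds h (fun _ => zero_le)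
    fun n => Gdist_le_ldist (hv n) hu

/-- Characterization of convergence in `𝒢₀` in terms of representatives. -/
theorem convergence_tfae (w : LGraph) (hws : Standard w) (hwf : FiniteNorm w)
    (g : ℕ → LGraph) (hg : ∀ n, Standard (g n) ∧ FiniteNorm (g n)) :
    (Filter.Tendsto (fun n => Gdist (g n) w) Filter.atTop (𝓝 0) ↔
      ∀ u ∈ cls w, ∃ v : ℕ → LGraph, (∀ n, v n ∈ cls (g n)) ∧
        Filter.Tendsto (fun n => ldist (v n) u) Filter.atTop (𝓝 0)) ∧
    ((∀ u ∈ cls w, ∃ v : ℕ → LGraph, (∀ n, v n ∈ cls (g n)) ∧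
        Filter.Tendsto (fun n => ldist (v n) u) Filter.atTop (𝓝 0)) ↔
      ∃ u ∈ cls w, ∃ v : ℕ → LGraph, (∀ n, v n ∈ cls (g n)) ∧
        Filter.Tendsto (fun n => ldist (v n) u) Filter.atTop (𝓝 0)) := by
  refine ⟨⟨fun h u hu => exists_tendsto_of_tendsto_Gdist hu h, fun h => ?_⟩,
    fun h => ⟨w, GIso.refl w, h w (GIso.refl w)⟩, ?_⟩
  · obtain ⟨v, hv, hlim⟩ := h w (GIso.refl w)
    exact tendsto_Gdist_of_tendsto_ldist (GIso.refl w) hv hlim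
  · rintro ⟨x, hx, v, hv, hlim⟩ u hu
    exact exists_tendsto_of_tendsto_Gdist hu (tendsto_Gdist_of_tendsto_ldist hx hv hlim)
end

section
/- If a sequence {wₙ} of standard labeled graphs of finite norm converges (in the norm distance d on labeled graphs) to some labeled graph w of finite norm (not necessarily standard), then the sequence of isomorphism classes {w̃ₙ} converges in the metric space 𝒢₀. -/
open scoped ENNReal
open Filter Topology

/-- The image of an edge under an injective map of the vertex set. -/
def mapEdgeOfInjective (f : ℕ → ℕ) (hf : f.Injective) (e : Edge) : Edge :=
  ⟨e.val.map f, fun h => e.prop ((Sym2.isDiag_map hf).mp h)⟩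

theorem mapEdgeOfInjective_injective (f : ℕ → ℕ) (hf : f.Injective) :
    (mapEdgeOfInjective f hf).Injective := fun _ _ h =>
  Subtype.ext (Sym2.map.injective hf (congrArg Subtype.val h))

/-- The permutation of the edges induced by a permutation of the vertex set. -/
def edgeEquiv (f : ℕ ≃ ℕ) : Edge ≃ Edge where
  toFun := mapEdge f
  invFun := mapEdge f.symm
  left_inv e := Subtype.ext (by simp [mapEdge, Sym2.map_map])
  right_inv e := Subtype.ext (by simp [mapEdge, Sym2.map_map])

theorem ldist_triangle (a b c : LGraph) : ldist a c ≤ ldist a b + ldist b c := by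
  unfold ldist
  rw [← ENNReal.tsum_add]
  refine ENNReal.tsum_le_tsum fun e => ?_
  rw [← ENNReal.ofReal_add (abs_nonneg _) (abs_nonneg _)]
  exact ENNReal.ofReal_le_ofReal (abs_sub_le _ _ _)

theorem gnorm_extend {j : Edge → Edge} (hj : j.Injective) (w : LGraph) :
    gnorm (Function.extend j w 0) = gnorm w := by
  unfold gnorm
  rw [← tsum_extend_zero hj fun e => ENNReal.ofReal |w e|]
  refine tsum_congr fun e => ?_
  by_cases he : ∃ a, j a = e
  · obtain ⟨a, rfl⟩ := he
    simp [hj.extend_apply]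
  · simp [Function.extend_apply' _ _ _ he]

/-- If an edge permutation `φ` agrees on `S` with an injection `j`, then transporting `w` along `j`
and pulling back along `φ` changes `w` by at most twice its mass outside `S`. -/
theorem ldist_extend_comp_le {j : Edge → Edge} (hj : j.Injective) (φ : Edge ≃ Edge)
    (S : Set Edge) (hS : ∀ e ∈ S, φ e = j e) (w : LGraph) :
    ldist w (fun e => Function.extend j w 0 (φ e)) ≤
      2 * ∑' e : Edge, Sᶜ.indicator (fun e => ENNReal.ofReal |w e|) e := by
  set v := Sᶜ.indicator (fun e => ENNReal.ofReal |w e|)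
  have hv : ∑' e, Function.extend j v 0 (φ e) = ∑' e, v e := by
    rw [φ.tsum_eq (Function.extend j v 0), tsum_extend_zero hj]
  rw [two_mul]
  nth_rw 2 [← hv]
  rw [← ENNReal.tsum_add]
  refine ENNReal.tsum_le_tsum fun e => ?_
  by_cases he : e ∈ S
  · simp [hS e he, hj.extend_apply]
  · have hve : v e = ENNReal.ofReal |w e| := Set.indicator_of_mem he _
    rw [hve]
    by_cases h : ∃ a, j a = φ e
    · obtain ⟨a, ha⟩ := h
      have haS : a ∉ S := fun haS => he (by
        rwa [← φ.injective ((hS a haS).trans ha)])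
      have hva : v a = ENNReal.ofReal |w a| := Set.indicator_of_mem haS _
      beta_reduce
      rw [← ha, hj.extend_apply, hj.extend_apply, hva,
        ← ENNReal.ofReal_add (abs_nonneg _) (abs_nonneg _)]
      exact ENNReal.ofReal_le_ofReal (abs_sub _ _)
    · simp [Function.extend_apply' _ _ _ h]

theorem exists_perm_eqOn_lt {f : ℕ → ℕ} (hf : f.Injective) (N : ℕ) :
    ∃ σ : ℕ ≃ ℕ, ∀ i < N, σ i = f i := by
  induction N with
  | zero => exact ⟨Equiv.refl _, by simp⟩
  | succ N ih =>
    obtain ⟨σ, hσ⟩ := ih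
    refine ⟨σ.trans (Equiv.swap (σ N) (f N)), fun i hi => ?_⟩
    rcases Nat.lt_succ_iff_lt_or_eq.mp hi with hi | rfl
    · rw [Equiv.trans_apply, Equiv.swap_apply_of_ne_of_ne, hσ i hi]
      · exact σ.injective.ne hi.ne
      · rw [hσ i hi]
        exact hf.ne hi.ne
    · simp

/-- Every labeled graph of finite norm is approximated arbitrarily well by isomorphic copies of
its transport along an injection of the vertex set. -/
theorem exists_mem_cls_ldist_le {f : ℕ → ℕ} (hf : f.Injective) {w : LGraph} (hw : FiniteNorm w)
    {ε : ℝ≥0∞} (hε : 0 < ε) :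
    ∃ u ∈ cls (Function.extend (mapEdgeOfInjective f hf) w 0), ldist w u ≤ 2 * ε := by
  have htail := ENNReal.tendsto_tsum_compl_atTop_zero hw
  obtain ⟨S, hS⟩ := (htail.eventually (ge_mem_nhds hε)).exists
  obtain ⟨σ, hσ⟩ := exists_perm_eqOn_lt hf
    ((S.biUnion fun e => e.val.toFinset).sup id + 1)
  refine ⟨fun e => Function.extend (mapEdgeOfInjective f hf) w 0 (edgeEquiv σ e),
    ⟨σ.symm, fun e => ?_⟩, ?_⟩
  · exact congrArg _ ((edgeEquiv σ).apply_symm_apply e).symm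
  · refine (ldist_extend_comp_le (mapEdgeOfInjective_injective f hf) (edgeEquiv σ) (S : Set Edge)
      (fun e he => Subtype.ext (Sym2.map_congr fun v hv => hσ v ?_)) w).trans ?_
    · exact Nat.lt_succ_of_le (Finset.le_sup (f := id)
        (Finset.mem_biUnion.mpr ⟨e, he, Sym2.mem_toFinset.mpr hv⟩))
    · gcongr
      rw [← tsum_subtype]
      exact hS

theorem mem_cls_self (w : LGraph) : w ∈ cls w :=
  ⟨Equiv.refl _, fun e => congrArg w (Subtype.ext (by simp [mapEdge]))⟩

theorem Gdist_extend_le {f : ℕ → ℕ} (hf : f.Injective) (g : LGraph) {w : LGraph}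
    (hw : FiniteNorm w) :
    Gdist g (Function.extend (mapEdgeOfInjective f hf) w 0) ≤ ldist g w := by
  refine ENNReal.le_of_forall_pos_le_add fun ε hε _ => ?_
  obtain ⟨u, hu, hle⟩ := exists_mem_cls_ldist_le hf hw
    (ENNReal.half_pos (ENNReal.coe_pos.mpr hε).ne')
  rw [ENNReal.mul_div_cancel two_ne_zero ENNReal.ofNat_ne_top] at hle
  calc Gdist g _ ≤ ldist g u := iInf₂_le_of_le g (mem_cls_self g) (iInf₂_le u hu)
    _ ≤ ldist g w + ldist w u := ldist_triangle _ _ _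
    _ ≤ ldist g w + ε := by gcongr

theorem isolated_extend {f : ℕ → ℕ} (hf : f.Injective) (w : LGraph) {v : ℕ}
    (hv : v ∉ Set.range f) :
    Isolated (Function.extend (mapEdgeOfInjective f hf) w 0) v := by
  intro e he
  refine Function.extend_apply' _ _ _ ?_
  rintro ⟨a, rfl⟩
  obtain ⟨x, -, hx⟩ := Sym2.mem_map.mp he
  exact hv ⟨x, hx⟩

/-- If a sequence of standard labeled graphs of finite norm converges in the norm
distance to a labeled graph of finite norm (not necessarily standard), then the
sequence of isomorphism classes converges in `𝒢₀`. -/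
theorem classes_converge_of_labels_converge (g : ℕ → LGraph)
    (hg : ∀ n, Standard (g n) ∧ FiniteNorm (g n))
    (w : LGraph) (hw : FiniteNorm w)
    (hconv : Filter.Tendsto (fun n => ldist (g n) w) Filter.atTop (𝓝 0)) :
    ∃ u : LGraph, Standard u ∧ FiniteNorm u ∧
      Filter.Tendsto (fun n => Gdist (g n) u) Filter.atTop (𝓝 0) := by
  have hf : (fun n : ℕ => 2 * n).Injective := mul_right_injective₀ two_ne_zero
  refine ⟨Function.extend (mapEdgeOfInjective _ hf) w 0, ?_, ?_, ?_⟩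
  · refine Set.infinite_of_injective_forall_mem (f := fun n : ℕ => 2 * n + 1)
      (fun a b h => by simpa using h) fun n => isolated_extend hf w ?_
    rintro ⟨m, hm⟩
    dsimp only at hm
    omega
  · rw [FiniteNorm, gnorm_extend (mapEdgeOfInjective_injective _ hf)]
    exact hw
  · exact tendsto_of_tendsto_of_tendsto_of_le_of_le tendsto_const_nhds hconv
      (fun _ => zero_le) fun n => Gdist_extend_le hf (g n) hw
end

section
/- Suppose w, w₁, w₂, … are labeled graphs of finite norm with d(wₙ, w) → 0, and {aₙ} is a sequence of nonnegative real numbers converging to 0. Then d(cut(wₙ, aₙ), w) → 0. -/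
open scoped ENNReal
open Filter Topology

theorem ofReal_abs_cutL_sub_le (u w : LGraph) (eps : ℝ) (e : Edge) :
    ENNReal.ofReal |cutL u eps e - w e| ≤
      2 * ENNReal.ofReal |u e - w e| + ENNReal.ofReal (min |w e| |2 * eps|) := by
  rw [show (2 : ℝ≥0∞) = ENNReal.ofReal 2 by simp, ← ENNReal.ofReal_mul zero_le_two,
    ← ENNReal.ofReal_add (by positivity) (by positivity)]
  apply ENNReal.ofReal_le_ofReal
  unfold cutL
  split_ifs <;> grind

theorem tendsto_tsum_ofReal_min {ι : Type*} {w : ι → ℝ} (hw : ∑' i, ENNReal.ofReal |w i| ≠ ⊤)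
    {b : ℕ → ℝ} (hb : Tendsto b atTop (𝓝 0)) :
    Tendsto (fun n => ∑' i, ENNReal.ofReal (min |w i| |b n|)) atTop (𝓝 0) := by
  have hs : Summable fun i => |w i| := by
    simpa [ENNReal.toReal_ofReal] using ENNReal.summable_toReal hw
  have hle (n : ℕ) (i : ι) : ‖min |w i| |b n|‖ ≤ |w i| := by
    rw [Real.norm_of_nonneg (by positivity)]
    exact min_le_left _ _
  have hlim : Tendsto (fun n => ∑' i, min |w i| |b n|) atTop (𝓝 (∑' _ : ι, (0 : ℝ))) := by
    refine tendsto_tsum_of_dominated_convergence hs (fun i => ?_) (.of_forall hle)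
    simpa using (tendsto_const_nhds (x := |w i|)).min hb.abs
  have := ENNReal.tendsto_ofReal hlim
  simp only [tsum_zero, ENNReal.ofReal_zero] at this
  refine this.congr fun n => ?_
  exact ENNReal.ofReal_tsum_of_nonneg (fun i => by positivity) (hs.of_norm_bounded (hle n))

/-- If `wₙ → w` in `W₀` and `aₙ ≥ 0` with `aₙ → 0`, then `cut(wₙ, aₙ) → w`. -/
theorem cut_tendsto (w : LGraph) (hw : FiniteNorm w)
    (g : ℕ → LGraph) (hg : ∀ n, FiniteNorm (g n))
    (a : ℕ → ℝ) (ha : ∀ n, 0 ≤ a n)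
    (ha0 : Filter.Tendsto a Filter.atTop (𝓝 0))
    (hconv : Filter.Tendsto (fun n => ldist (g n) w) Filter.atTop (𝓝 0)) :
    Filter.Tendsto (fun n => ldist (cutL (g n) (a n)) w) Filter.atTop (𝓝 0) := by
  have hmin := tendsto_tsum_ofReal_min hw (b := fun n => 2 * a n) (by simpa using ha0.const_mul 2)
  have hbound := (ENNReal.Tendsto.const_mul hconv (.inr (ENNReal.ofNat_ne_top (n := 2)))).add hmin
  simp only [mul_zero, add_zero] at hbound
  refine tendsto_of_tendsto_of_tendsto_of_le_of_le tendsto_const_nhds hbound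
    (fun _ => zero_le) fun n => ?_
  simp only [ldist]
  rw [← ENNReal.tsum_mul_left, ← ENNReal.tsum_add]
  exact ENNReal.tsum_le_tsum (ofReal_abs_cutL_sub_le (g n) w (a n))
end

section
/- The set Ĝ₀ of jointless unlabeled graphs of finite norm is a complete subspace of the metric space (𝒢₀, d). -/
open scoped ENNReal
open Filter Topology

/-- A graph is jointless if no two edges of nonzero weight share a vertex. -/
def Jointless (w : LGraph) : Prop :=
  ∀ e e' : Edge, e ≠ e' → w e ≠ 0 → w e' ≠ 0 → ∀ v : ℕ, v ∈ e.val → v ∉ e'.val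

/-- The map on edges induced by an injection of the vertex set. -/
def embEdge (f : ℕ ↪ ℕ) : Edge ↪ Edge where
  toFun e := ⟨e.val.map f, fun h => e.prop ((Sym2.isDiag_map f.injective).mp h)⟩
  inj' _ _ h := Subtype.ext (Sym2.map.injective f.injective (congrArg Subtype.val h))

theorem mem_embEdge (f : ℕ ↪ ℕ) (e : Edge) (v : ℕ) (hv : v ∈ e.val) :
    f v ∈ (embEdge f e).val :=
  Sym2.mem_map.mpr ⟨v, hv, rfl⟩

/-- The bijection of the edges induced by a bijection of the vertices. -/
def permEdge (f : ℕ ≃ ℕ) : Edge ≃ Edge where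
  toFun := mapEdge f
  invFun := mapEdge f.symm
  left_inv e := Subtype.ext (by simp [mapEdge, Sym2.map_map])
  right_inv e := Subtype.ext (by simp [mapEdge, Sym2.map_map])

/-- The labeled graph obtained from `w` by renaming the vertices along `f`. -/
def reindex (f : ℕ ≃ ℕ) (w : LGraph) : LGraph := fun e => w (permEdge f e)

theorem reindex_reindex (f h : ℕ ≃ ℕ) (w : LGraph) :
    reindex f (reindex h w) = reindex (f.trans h) w :=
  funext fun e => congrArg w (Subtype.ext (by simp [permEdge, mapEdge, Sym2.map_map]))

theorem reindex_refl (w : LGraph) : reindex (Equiv.refl ℕ) w = w :=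
  funext fun e => congrArg w (Subtype.ext (by simp [permEdge, mapEdge]))

theorem reindex_symm_reindex (f : ℕ ≃ ℕ) (w : LGraph) : reindex f.symm (reindex f w) = w := by
  rw [reindex_reindex, Equiv.symm_trans_self, reindex_refl]

theorem ldist_reindex (f : ℕ ≃ ℕ) (w w' : LGraph) :
    ldist (reindex f w) (reindex f w') = ldist w w' :=
  (permEdge f).tsum_eq fun e => ENNReal.ofReal |w e - w' e|

theorem gnorm_reindex (f : ℕ ≃ ℕ) (w : LGraph) : gnorm (reindex f w) = gnorm w :=
  (permEdge f).tsum_eq fun e => ENNReal.ofReal |w e|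

theorem ldist_eq_tsum_edist (w w' : LGraph) : ldist w w' = ∑' e, edist (w e) (w' e) := by
  simp only [ldist, edist_dist, Real.dist_eq]

theorem gnorm_eq_ldist_zero (w : LGraph) : gnorm w = ldist w 0 := by
  simp [gnorm, ldist]

theorem ldist_comm (w w' : LGraph) : ldist w w' = ldist w' w := by
  simp only [ldist, abs_sub_comm]

theorem ldist_triangle_s14 (w₁ w₂ w₃ : LGraph) : ldist w₁ w₃ ≤ ldist w₁ w₂ + ldist w₂ w₃ := by
  simp only [ldist_eq_tsum_edist, ← ENNReal.tsum_add]
  exact ENNReal.tsum_le_tsum fun e => edist_triangle _ _ _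

theorem Gdist_eq_iInf (w₁ w₂ : LGraph) : Gdist w₁ w₂ = ⨅ f, ldist w₁ (reindex f w₂) := by
  apply le_antisymm
  · refine le_iInf fun f => ?_
    refine iInf₂_le_of_le w₁ ⟨Equiv.refl ℕ, fun e => congrFun (reindex_refl w₁).symm e⟩ ?_
    exact iInf₂_le (reindex f w₂)
      ⟨f.symm, fun e => congrFun (reindex_symm_reindex f w₂).symm e⟩
  · refine le_iInf₂ fun u hu => le_iInf₂ fun v hv => ?_
    obtain ⟨f, hf⟩ := hu
    obtain ⟨h, hh⟩ := hv
    obtain rfl : w₁ = reindex f u := funext hf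
    obtain rfl : w₂ = reindex h v := funext hh
    refine iInf_le_of_le (f.trans h.symm) ?_
    rw [← reindex_reindex, reindex_symm_reindex, ldist_reindex]

theorem Gdist_triangle (w₁ w₂ w₃ : LGraph) : Gdist w₁ w₃ ≤ Gdist w₁ w₂ + Gdist w₂ w₃ := by
  simp only [Gdist_eq_iInf, ENNReal.iInf_add, ENNReal.add_iInf]
  refine le_iInf fun h => le_iInf fun f => iInf_le_of_le (f.trans h) ?_
  rw [← reindex_reindex, ← ldist_reindex f w₂]
  exact ldist_triangle_s14 _ _ _

theorem Gdist_le_ldist_reindex (f : ℕ ≃ ℕ) (w w' : LGraph) :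
    Gdist w w' ≤ ldist (reindex f w) w' := by
  rw [Gdist_eq_iInf]
  refine iInf_le_of_le f.symm ?_
  rw [← ldist_reindex f]
  exact (congrArg (ldist _) (reindex_symm_reindex f.symm w')).le

theorem Jointless.reindex {w : LGraph} (hw : Jointless w) (f : ℕ ≃ ℕ) :
    Jointless (reindex f w) := fun e e' hne h h' v hv hv' =>
  hw _ _ ((permEdge f).injective.ne hne) h h' (f v)
    (mem_embEdge f.toEmbedding e v hv) (mem_embEdge f.toEmbedding e' v hv')

/-- The labeled graph `w` pushed forward along an injection of the vertices. -/
noncomputable def push (f : ℕ ↪ ℕ) (w : LGraph) : LGraph := Function.extend (embEdge f) w 0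

theorem push_embEdge (f : ℕ ↪ ℕ) (w : LGraph) (e : Edge) : push f w (embEdge f e) = w e :=
  (embEdge f).injective.extend_apply _ _ _

theorem push_of_notMem (f : ℕ ↪ ℕ) (w : LGraph) {e : Edge} (he : ¬ ∃ e₀, embEdge f e₀ = e) :
    push f w e = 0 :=
  Function.extend_apply' _ _ _ he

theorem exists_embEdge_of_push_ne_zero {f : ℕ ↪ ℕ} {w : LGraph} {e : Edge}
    (he : push f w e ≠ 0) : ∃ e₀, embEdge f e₀ = e :=
  not_not.mp fun h => he (push_of_notMem f w h)

theorem gnorm_push (f : ℕ ↪ ℕ) (w : LGraph) : gnorm (push f w) = gnorm w := by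
  unfold gnorm
  rw [← (embEdge f).injective.tsum_eq (f := fun e => ENNReal.ofReal |push f w e|)]
  · simp only [push_embEdge]
  · intro e he
    exact exists_embEdge_of_push_ne_zero (w := w) fun h => he (by simp [h])

theorem Jointless.push {w : LGraph} (hw : Jointless w) (f : ℕ ↪ ℕ) : Jointless (push f w) := by
  intro e e' hne h h' v hv hv'
  obtain ⟨e₀, rfl⟩ := exists_embEdge_of_push_ne_zero h
  obtain ⟨e₁, rfl⟩ := exists_embEdge_of_push_ne_zero h'
  rw [push_embEdge] at h h'
  obtain ⟨x, hx, rfl⟩ := Sym2.mem_map.mp hv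
  obtain ⟨y, hy, hxy⟩ := Sym2.mem_map.mp hv'
  rw [f.injective hxy] at hy
  exact hw e₀ e₁ (fun h => hne (congrArg _ h)) h h' x hx hy

theorem standard_push {f : ℕ ↪ ℕ} (hf : (Set.range f)ᶜ.Infinite) (w : LGraph) :
    Standard (push f w) := by
  refine hf.mono fun v hv e hve => push_of_notMem f w ?_
  rintro ⟨e₀, rfl⟩
  obtain ⟨x, -, rfl⟩ := Sym2.mem_map.mp hve
  exact hv ⟨x, rfl⟩

theorem exists_perm_eqOn_finite (f : ℕ ↪ ℕ) (s : Set ℕ) (hs : s.Finite) :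
    ∃ h : ℕ ≃ ℕ, ∀ v ∈ s, h v = f v := by
  obtain ⟨h, hh⟩ := Cardinal.extend_function_of_lt ((Function.Embedding.subtype _).trans f : s ↪ ℕ)
    (by simpa using hs.lt_aleph0) ⟨Equiv.refl ℕ⟩
  exact ⟨h, fun v hv => hh ⟨v, hv⟩⟩

theorem exists_perm_embEdge_eqOn (f : ℕ ↪ ℕ) (F : Finset Edge) :
    ∃ h : ℕ ≃ ℕ, ∀ e ∈ F, permEdge h e = embEdge f e := by
  obtain ⟨h, hh⟩ := exists_perm_eqOn_finite f (⋃ e ∈ F, {v | v ∈ e.val})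
    (F.finite_toSet.biUnion fun e _ => by
      induction e using Subtype.rec with
      | mk e _ => induction e using Sym2.ind with
        | _ a b => simp only [Sym2.mem_iff]; exact (Set.toFinite {a, b}))
  refine ⟨h, fun e he => Subtype.ext (Sym2.map_congr fun v hv => hh v ?_)⟩
  exact Set.mem_biUnion (x := e) he hv

theorem ldist_reindex_symm_push_le (f : ℕ ↪ ℕ) (w : LGraph) (F : Finset Edge) (h : ℕ ≃ ℕ)
    (hF : ∀ e ∈ F, permEdge h e = embEdge f e) :
    ldist (reindex h.symm w) (push f w) ≤ 2 * gnorm (fun e => if e ∈ F then 0 else w e) := by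
  set r : LGraph := fun e => if e ∈ F then 0 else w e with hr
  rw [two_mul]
  nth_rw 1 [← gnorm_reindex h.symm r]
  rw [← gnorm_push f r, gnorm, gnorm, ← ENNReal.tsum_add]
  refine ENNReal.tsum_le_tsum fun e => ?_
  rw [← ENNReal.ofReal_add (abs_nonneg _) (abs_nonneg _)]
  apply ENNReal.ofReal_le_ofReal
  obtain ⟨e₁, rfl⟩ := (permEdge h).surjective e
  have key (u : LGraph) : reindex h.symm u (permEdge h e₁) = u e₁ :=
    congrArg u ((permEdge h).symm_apply_apply e₁)
  rw [key, key]
  by_cases h₁ : e₁ ∈ F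
  · rw [hF e₁ h₁, push_embEdge, push_embEdge]
    simp [hr, h₁]
  by_cases h₀ : ∃ e₀, embEdge f e₀ = permEdge h e₁
  · obtain ⟨e₀, he₀⟩ := h₀
    have hn : e₀ ∉ F := fun hm => by
      rw [← hF e₀ hm] at he₀
      exact h₁ ((permEdge h).injective he₀ ▸ hm)
    rw [← he₀, push_embEdge, push_embEdge]
    simpa [hr, h₁, hn] using abs_sub (w e₁) (w e₀)
  · rw [push_of_notMem f w h₀, push_of_notMem f r h₀]
    simp [hr, h₁]

theorem exists_finset_gnorm_lt {w : LGraph} (hw : FiniteNorm w) {ε : ℝ≥0∞} (hε : 0 < ε) :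
    ∃ F : Finset Edge, gnorm (fun e => if e ∈ F then 0 else w e) < ε := by
  obtain ⟨F, hF⟩ := ((ENNReal.tendsto_tsum_compl_atTop_zero hw).eventually_lt_const hε).exists
  refine ⟨F, lt_of_eq_of_lt ?_ hF⟩
  rw [gnorm, ← tsum_subtype_eq_of_support_subset (s := {e | e ∉ F})]
  · exact tsum_congr fun e => by rw [if_neg e.2]
  · intro e he hm
    simp [hm] at he

theorem Gdist_push {w : LGraph} (hw : FiniteNorm w) (f : ℕ ↪ ℕ) : Gdist w (push f w) = 0 := by
  refine nonpos_iff_eq_zero.mp (le_of_forall_gt_imp_ge_of_dense fun ε hε => ?_)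
  obtain ⟨F, hF⟩ := exists_finset_gnorm_lt hw (ENNReal.half_pos hε.ne')
  obtain ⟨h, hh⟩ := exists_perm_embEdge_eqOn f F
  calc Gdist w (push f w) ≤ ldist (reindex h.symm w) (push f w) := Gdist_le_ldist_reindex _ _ _
    _ ≤ 2 * gnorm (fun e => if e ∈ F then 0 else w e) := ldist_reindex_symm_push_le f w F h hh
    _ ≤ 2 * (ε / 2) := by gcongr
    _ = ε := ENNReal.mul_div_cancel two_ne_zero ENNReal.ofNat_ne_top

theorem ldist_le_tsum_of_tendsto {u : ℕ → LGraph} {a : LGraph}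
    (h : ∀ e, Tendsto (fun k => u k e) atTop (𝓝 (a e))) (k : ℕ) :
    ldist (u k) a ≤ ∑' m, ldist (u (k + m)) (u (k + m + 1)) := by
  simp only [ldist_eq_tsum_edist]
  rw [ENNReal.tsum_comm]
  exact ENNReal.tsum_le_tsum fun e => edist_le_tsum_of_edist_le_of_tendsto
    (fun m => edist (u m e) (u (m + 1) e)) (fun _ => le_rfl) (h e) k

theorem exists_ldist_limit {u : ℕ → LGraph}
    (hu : ∀ k, ldist (u k) (u (k + 1)) ≤ 2⁻¹ ^ k) :
    ∃ a : LGraph, (∀ e, Tendsto (fun k => u k e) atTop (𝓝 (a e))) ∧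
      ∀ k, ldist (u k) a ≤ 2 * 2⁻¹ ^ k := by
  have hlim (e : Edge) : ∃ x, Tendsto (fun k => u k e) atTop (𝓝 x) := by
    refine cauchySeq_tendsto_of_complete
      (cauchySeq_of_edist_le_geometric 2⁻¹ 1 (by simp) (by simp) fun k => ?_)
    rw [one_mul]
    refine le_trans ?_ (hu k)
    rw [ldist_eq_tsum_edist]
    exact ENNReal.le_tsum e
  choose a ha using hlim
  refine ⟨a, ha, fun k => (ldist_le_tsum_of_tendsto ha k).trans ?_⟩
  refine (ENNReal.tsum_le_tsum fun m => hu (k + m)).trans_eq ?_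
  simp only [pow_add, ENNReal.tsum_mul_left, ENNReal.tsum_geometric]
  rw [ENNReal.one_sub_inv_two, inv_inv, mul_comm]

theorem Jointless.of_tendsto {u : ℕ → LGraph} {a : LGraph} (hu : ∀ k, Jointless (u k))
    (h : ∀ e, Tendsto (fun k => u k e) atTop (𝓝 (a e))) : Jointless a := by
  intro e e' hne he he'
  obtain ⟨k, hk, hk'⟩ := (((h e).eventually_ne he).and ((h e').eventually_ne he')).exists
  exact hu k e e' hne hk hk'

/-- Consecutive terms that are close up to isomorphism can be reindexed to be close. -/
theorem exists_reindex_ldist_lt {w : ℕ → LGraph} {ε : ℕ → ℝ≥0∞}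
    (hw : ∀ k, Gdist (w k) (w (k + 1)) < ε k) :
    ∃ F : ℕ → ℕ ≃ ℕ, ∀ k,
      ldist (reindex (F k) (w k)) (reindex (F (k + 1)) (w (k + 1))) < ε k := by
  simp only [Gdist_eq_iInf, iInf_lt_iff] at hw
  choose f hf using hw
  refine ⟨fun k => Nat.rec (Equiv.refl ℕ) (fun k F => F.trans (f k)) k, fun k => ?_⟩
  rw [← reindex_reindex, ldist_reindex]
  exact hf k

/-- The doubling map on vertices. -/
def doubling : ℕ ↪ ℕ := ⟨fun v => 2 * v, fun _ _ h => Nat.eq_of_mul_eq_mul_left two_pos h⟩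

theorem infinite_compl_range_doubling : (Set.range doubling)ᶜ.Infinite := by
  refine Set.infinite_of_injective_forall_mem (f := fun v : ℕ => 2 * v + 1)
    (fun a b h => by simpa using h) ?_
  rintro v ⟨x, hx⟩
  change 2 * x = 2 * v + 1 at hx
  omega

/-- `Ĝ₀`, the set of jointless unlabeled graphs of finite norm, is a complete
subspace of `𝒢₀`: every Cauchy sequence of jointless graphs converges to a
jointless graph. -/
theorem jointless_complete (g : ℕ → LGraph)
    (hg : ∀ n, Standard (g n) ∧ FiniteNorm (g n) ∧ Jointless (g n))
    (hC : ∀ eps : ℝ≥0∞, 0 < eps → ∃ N : ℕ, ∀ m, N ≤ m → ∀ n, N ≤ n →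
      Gdist (g m) (g n) < eps) :
    ∃ u : LGraph, Standard u ∧ FiniteNorm u ∧ Jointless u ∧
      Filter.Tendsto (fun n => Gdist (g n) u) Filter.atTop (𝓝 0) := by
  choose N hN using fun k : ℕ => hC (2⁻¹ ^ k) (ENNReal.pow_pos (by simp) k)
  set n : ℕ → ℕ := fun k => (Finset.range (k + 1)).sup N
  have hn {i k : ℕ} (hik : i ≤ k) : N i ≤ n k :=
    Finset.le_sup (Finset.mem_range.mpr (Nat.lt_succ_of_le hik))
  obtain ⟨F, hF⟩ := exists_reindex_ldist_lt (w := fun k => g (n k)) (ε := fun k => 2⁻¹ ^ k)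
    fun k => hN k _ (hn le_rfl) _ (hn k.le_succ)
  obtain ⟨a, ha, hdist⟩ := exists_ldist_limit fun k => (hF k).le
  have hJ : Jointless a := Jointless.of_tendsto (fun k => (hg (n k)).2.2.reindex (F k)) ha
  have hfin : FiniteNorm a := by
    rw [FiniteNorm, gnorm_eq_ldist_zero]
    refine ne_top_of_le_ne_top (ENNReal.add_ne_top.mpr ⟨?_, ?_⟩)
      (ldist_triangle_s14 a (reindex (F 0) (g (n 0))) 0)
    · rw [ldist_comm]
      exact ne_top_of_le_ne_top (by simp) (hdist 0)
    · rw [← gnorm_eq_ldist_zero, gnorm_reindex]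
      exact (hg (n 0)).2.1
  refine ⟨push doubling a, standard_push infinite_compl_range_doubling a,
    by rwa [FiniteNorm, gnorm_push], hJ.push doubling, ?_⟩
  have hbound (k m : ℕ) (hm : N k ≤ m) : Gdist (g m) (push doubling a) ≤ 3 * 2⁻¹ ^ k := calc
    Gdist (g m) (push doubling a)
      ≤ Gdist (g m) (g (n k)) + Gdist (g (n k)) a + Gdist a (push doubling a) :=
        (Gdist_triangle _ a _).trans (add_le_add_left (Gdist_triangle _ _ _) _)
    _ ≤ 2⁻¹ ^ k + 2 * 2⁻¹ ^ k + 0 := by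
        gcongr
        · exact (hN k m hm _ (hn le_rfl)).le
        · exact (Gdist_le_ldist_reindex (F k) _ _).trans (hdist k)
        · exact (Gdist_push hfin doubling).le
    _ = 3 * 2⁻¹ ^ k := by ring
  have hpow : Tendsto (fun k : ℕ => (3 : ℝ≥0∞) * 2⁻¹ ^ k) atTop (𝓝 0) := by
    simpa using ENNReal.Tendsto.const_mul
      (ENNReal.tendsto_pow_atTop_nhds_zero_of_lt_one (r := 2⁻¹) (by simp))
      (Or.inr (ENNReal.ofNat_ne_top (n := 3)))
  refine ENNReal.tendsto_nhds_zero.mpr fun ε hε => ?_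
  obtain ⟨k, hk⟩ := (hpow.eventually_le_const hε).exists
  exact eventually_atTop.mpr ⟨N k, fun m hm => (hbound k m hm).trans hk⟩
end

section
/- The metric space (𝒢₀, d) is separable; in fact, the set of (isomorphism classes of) graphs having only finitely many nonzero edges, all with rational weights, is a countable dense subset of 𝒢₀. -/
open scoped ENNReal
open Filter Topology

theorem Gdist_le_ldist_s16 (w w' : LGraph) : Gdist w w' ≤ ldist w w' :=
  iInf₂_le_of_le w (GIso.refl w) (iInf₂_le_of_le w' (GIso.refl w') le_rfl)

theorem standard_of_finite_ne_zero {w : LGraph} (hw : {e : Edge | w e ≠ 0}.Finite) :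
    Standard w := by
  have hfin : (⋃ e ∈ {e : Edge | w e ≠ 0}, {v : ℕ | v ∈ e.val}).Finite := by
    refine hw.biUnion fun e _ => ?_
    refine e.val.toFinset.finite_toSet.subset fun v hv => ?_
    simpa using hv
  refine hfin.infinite_compl.mono fun v hv e hve => ?_
  by_contra hne
  exact hv (Set.mem_biUnion (x := e) hne hve)

theorem finiteNorm_of_finite_ne_zero {w : LGraph} (hw : {e : Edge | w e ≠ 0}.Finite) :
    FiniteNorm w := by
  unfold FiniteNorm gnorm
  rw [tsum_eq_sum (s := hw.toFinset) fun e he => by simp_all]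
  exact (ENNReal.sum_lt_top.2 fun e _ => ENNReal.ofReal_lt_top).ne

theorem exists_finsupp_ldist_lt {w : LGraph} (hw : FiniteNorm w) {eps : ℝ≥0∞} (heps : 0 < eps) :
    ∃ x : Edge →₀ ℚ, ldist w (fun e => (x e : ℝ)) < eps := by
  classical
  have hhalf : eps / 2 ≠ 0 := (ENNReal.half_pos heps.ne').ne'
  obtain ⟨s, hs⟩ := ((ENNReal.tendsto_tsum_compl_atTop_zero hw).eventually
    (gt_mem_nhds (pos_iff_ne_zero.2 hhalf))).exists
  obtain ⟨δ, hδ, hsum⟩ := ENNReal.exists_pos_sum_of_countable hhalf Edge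
  choose q hq using fun e : Edge =>
    exists_rat_btwn (show w e - δ e < w e by have := hδ e; simpa using this)
  refine ⟨Finsupp.onFinset s (fun e => if e ∈ s then q e else 0) (by simp_all), ?_⟩
  calc
    ldist w _ ≤ ∑' e : Edge,
        ((δ e : ℝ≥0∞) + (sᶜ : Set Edge).indicator (fun e => ENNReal.ofReal |w e|) e) := by
      refine ENNReal.tsum_le_tsum fun e => ?_
      by_cases he : e ∈ s
      · have h : |w e - q e| ≤ δ e := by
          rw [abs_le]
          have := hq e
          have := (δ e).coe_nonneg
          constructor <;> linarith
        simpa [he] using ENNReal.ofReal_le_ofReal h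
      · simp [he]
    _ = (∑' e, (δ e : ℝ≥0∞)) + ∑' e : {e // e ∉ s}, ENNReal.ofReal |w e| := by
      rw [ENNReal.tsum_add, ← tsum_subtype]
      rfl
    _ < eps / 2 + eps / 2 := ENNReal.add_lt_add hsum hs
    _ = eps := ENNReal.add_halves eps

/-- `𝒢₀` is separable: the classes of graphs with finitely many nonzero edges, all
of rational weight, form a countable dense subset. -/
theorem G0_separable :
    ∃ D : ℕ → LGraph,
      (∀ n, Standard (D n) ∧ FiniteNorm (D n) ∧
        {e : Edge | D n e ≠ 0}.Finite ∧ ∀ e : Edge, ∃ q : ℚ, D n e = (q : ℝ)) ∧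
      ∀ w : LGraph, Standard w → FiniteNorm w →
        ∀ eps : ℝ≥0∞, 0 < eps → ∃ n : ℕ, Gdist w (D n) < eps := by
  obtain ⟨x, hx⟩ := exists_surjective_nat (Edge →₀ ℚ)
  have hfin (n : ℕ) : {e : Edge | ((x n e : ℚ) : ℝ) ≠ 0}.Finite :=
    (x n).support.finite_toSet.subset fun e he => by simpa using he
  refine ⟨fun n e => (x n e : ℝ), fun n => ⟨standard_of_finite_ne_zero (hfin n),
    finiteNorm_of_finite_ne_zero (hfin n), hfin n, fun e => ⟨x n e, rfl⟩⟩, ?_⟩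
  intro w _ hw eps heps
  obtain ⟨y, hy⟩ := exists_finsupp_ldist_lt hw heps
  obtain ⟨n, rfl⟩ := hx y
  exact ⟨n, (Gdist_le_ldist_s16 _ _).trans_lt hy⟩
end
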